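/- arXiv:math/0701308 — 4 statements merged into one kernel-verified Lean document; each statement's English description precedes it below -/
import Mathlib

section
/- Let A ∗_C B be a free product with amalgamation, where C embeds into A and into B via injective homomorphisms ι_A : C → A and ι_B : C → B whose images are proper subgroups of A and of B respectively. Then an element of A ∗_C B is central if and only if it is the image of some c ∈ C such that ι_A(c) is central in A and ι_B(c) is central in B. In particular, the centre of A ∗_C B coincides with the intersection of the centres of the factors (taken inside the amalgamated subgroup). -/
namespace Monoid.PushoutI

open CoprodI

section Center

variable {ι : Type*} {G : ι → Type*} {H : Type*} [∀ i, Group (G i)] [Group H]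
  {φ : ∀ i, H →* G i}

theorem NormalWord.reduced_toWord {d : NormalWord.Transversal φ} (w : NormalWord d) :
    Reduced φ w.toWord := by
  intro g hg hrange
  refine w.ne_one g hg ?_
  rw [← (d.compl g.1).equiv_snd_eq_self_iff_mem (one_mem _) |>.2 (w.normalized g.1 g.2 hg)]
  exact ((d.compl g.1).coe_equiv_snd_eq_one_iff_mem (d.one_mem _)).2 hrange

theorem exists_reduced_word_base_mul (hφ : ∀ i, Function.Injective (φ i)) (x : PushoutI φ) :
    ∃ (h : H) (w : Word G), Reduced φ w ∧ x = base φ h * ofCoprodI w.prod := by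
  classical
  obtain ⟨d⟩ := NormalWord.transversal_nonempty φ hφ
  refine ⟨(NormalWord.equiv (d := d) x).head, (NormalWord.equiv (d := d) x).toWord,
    NormalWord.reduced_toWord _, ?_⟩
  exact (NormalWord.equiv.symm_apply_apply x).symm

theorem Reduced.map_fst_eq_of_prod_eq (hφ : ∀ i, Function.Injective (φ i)) {w₁ w₂ : Word G}
    (hw₁ : Reduced φ w₁) (hw₂ : Reduced φ w₂)
    (h : (ofCoprodI w₁.prod : PushoutI φ) = ofCoprodI w₂.prod) :
    w₁.toList.map Sigma.fst = w₂.toList.map Sigma.fst := by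
  obtain ⟨d⟩ := NormalWord.transversal_nonempty φ hφ
  obtain ⟨v₁, hv₁, hl₁⟩ := hw₁.exists_normalWord_prod_eq d
  obtain ⟨v₂, hv₂, hl₂⟩ := hw₂.exists_normalWord_prod_eq d
  rw [← hl₁, ← hl₂, NormalWord.prod_injective (hv₁.trans (h.trans hv₂.symm))]

theorem Reduced.length_le_one_of_mem_range_of (hφ : ∀ i, Function.Injective (φ i)) {w : Word G}
    (hw : Reduced φ w) {k : ι} (h : (ofCoprodI w.prod : PushoutI φ) ∈ (of (φ := φ) k).range) :
    w.toList.length ≤ 1 := by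
  obtain ⟨g, hg⟩ := h
  by_cases hgr : g ∈ (φ k).range
  · obtain ⟨c, rfl⟩ := hgr
    rw [hw.eq_empty_of_mem_range hφ ⟨c, by rw [← hg, of_apply_eq_base]⟩]
    simp [Word.empty]
  · have hg1 : g ≠ 1 := fun h => hgr (h ▸ one_mem _)
    have hv : Reduced φ (NeWord.singleton g hg1).toWord := by
      simpa [Reduced, NeWord.toWord] using hgr
    have hl := congrArg List.length <| hw.map_fst_eq_of_prod_eq hφ hv <| by
      rw [← hg]
      simp [NeWord.toWord, Word.prod]
    simpa [NeWord.toWord] using hl.le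

theorem Reduced.toWord_inv {i j : ι} {w : NeWord G i j} (hw : Reduced φ w.toWord) :
    Reduced φ w.inv.toWord := by
  induction w with
  | singleton x hx =>
    simp only [Reduced, NeWord.toWord, NeWord.inv, NeWord.toList, List.mem_singleton, forall_eq,
      inv_mem_iff] at *
    exact hw
  | append w₁ hne w₂ ih₁ ih₂ =>
    simp only [Reduced, NeWord.toWord, NeWord.inv, NeWord.toList, List.mem_append] at *
    grind

theorem Reduced.toWord_append {i j k l : ι} {w₁ : NeWord G i j} {w₂ : NeWord G k l}
    (hne : j ≠ k) (hw₁ : Reduced φ w₁.toWord) (hw₂ : Reduced φ w₂.toWord) :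
    Reduced φ (w₁.append hne w₂).toWord := by
  simp only [Reduced, NeWord.toWord, NeWord.toList, List.mem_append] at *
  grind

theorem center_le_range_base [Nontrivial ι] (hφ : ∀ i, Function.Injective (φ i))
    (hproper : ∀ i, (φ i).range ≠ ⊤) :
    Subgroup.center (PushoutI φ) ≤ (base φ).range := by
  intro x hx
  obtain ⟨h, w, hw, rfl⟩ := exists_reduced_word_base_mul hφ x
  rcases eq_or_ne w Word.empty with rfl | hne
  · exact ⟨h, by simp⟩
  obtain ⟨i, j, v, rfl⟩ := NeWord.of_word w hne
  obtain ⟨k, hk⟩ := exists_ne j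
  obtain ⟨g, hg⟩ := SetLike.exists_not_mem_of_ne_top _ (hproper k) rfl
  have hg1 : g ≠ 1 := fun h => hg (h ▸ one_mem _)
  have hs : Reduced φ (NeWord.singleton g hg1).toWord := by
    simpa [Reduced, NeWord.toWord] using hg
  have hr := (hw.toWord_append hk.symm hs).toWord_append hk hw.toWord_inv
  have hlen := hr.length_le_one_of_mem_range_of hφ (k := k) <| by
    refine ⟨φ k h⁻¹ * g * φ k h, ?_⟩
    have hcomm := Subgroup.mem_center_iff.1 hx (of k g)
    change _ = ofCoprodI (NeWord.prod _)
    change _ * (_ * ofCoprodI v.prod) = _ * ofCoprodI v.prod * _ at hcomm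
    simp only [map_mul, of_apply_eq_base, NeWord.append_prod, NeWord.inv_prod,
      NeWord.prod_singleton, ofCoprodI_of, map_inv]
    rw [eq_mul_inv_iff_mul_eq, mul_assoc, mul_assoc, inv_mul_eq_iff_eq_mul, hcomm, mul_assoc]
  have hpos := List.length_pos_iff.2 v.toList_ne_nil
  simp [NeWord.toWord] at hlen
  omega

end Center

end Monoid.PushoutI

section AmalgamatedProduct

open Monoid

universe u v w

variable {A : Type u} {B : Type v} {C : Type w} [Group A] [Group B] [Group C]

/-- The family consisting of the two factors, lifted to a common universe. -/
def AmalgamFactor (A : Type u) (B : Type v) : Bool → Type (max u v)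
  | false => ULift.{v} A
  | true => ULift.{u} B

instance : ∀ b, Group (AmalgamFactor A B b)
  | false => inferInstanceAs (Group (ULift.{v} A))
  | true => inferInstanceAs (Group (ULift.{u} B))

/-- The inclusions of the amalgamated subgroup into the two factors. -/
def amalgamMap (ιA : C →* A) (ιB : C →* B) : ∀ b, C →* AmalgamFactor A B b
  | false => (MulEquiv.ulift.symm : A ≃* ULift.{v} A).toMonoidHom.comp ιA
  | true => (MulEquiv.ulift.symm : B ≃* ULift.{u} B).toMonoidHom.comp ιB

theorem amalgamMap_injective {ιA : C →* A} {ιB : C →* B} (hA : Function.Injective ιA)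
    (hB : Function.Injective ιB) : ∀ b, Function.Injective (amalgamMap ιA ιB b)
  | false => (MulEquiv.ulift.symm : A ≃* ULift.{v} A).injective.comp hA
  | true => (MulEquiv.ulift.symm : B ≃* ULift.{u} B).injective.comp hB

theorem amalgamMap_range_ne_top {ιA : C →* A} {ιB : C →* B} (hA : ιA.range ≠ ⊤)
    (hB : ιB.range ≠ ⊤) : ∀ b, (amalgamMap ιA ιB b).range ≠ ⊤
  | false => fun h => hA <| MonoidHom.range_eq_top.2 <|
      ((MulEquiv.ulift.symm : A ≃* ULift.{v} A).comp_surjective _).1 (MonoidHom.range_eq_top.1 h)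
  | true => fun h => hB <| MonoidHom.range_eq_top.2 <|
      ((MulEquiv.ulift.symm : B ≃* ULift.{u} B).comp_surjective _).1 (MonoidHom.range_eq_top.1 h)

/-- The subgroup of relations identifying the two copies of the amalgamated subgroup. -/
abbrev amalgamRelations (ιA : C →* A) (ιB : C →* B) : Subgroup (Coprod A B) :=
  Subgroup.normalClosure {u : Coprod A B | ∃ c : C,
    u = Coprod.inl (ιA c) * (Coprod.inr (ιB c))⁻¹}

theorem mk_inl_eq_mk_inr (ιA : C →* A) (ιB : C →* B) (c : C) :
    (QuotientGroup.mk (Coprod.inl (ιA c)) : Coprod A B ⧸ amalgamRelations ιA ιB) =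
      QuotientGroup.mk (Coprod.inr (ιB c)) := by
  rw [← mul_inv_eq_one]
  exact (QuotientGroup.eq_one_iff _).2 (Subgroup.subset_normalClosure ⟨c, rfl⟩)

/-- The first factor mapped to the indexed pushout. -/
def amalgamInl (ιA : C →* A) (ιB : C →* B) : A →* PushoutI (amalgamMap ιA ιB) :=
  (PushoutI.of (φ := amalgamMap ιA ιB) false).comp
    (MulEquiv.ulift.symm : A ≃* ULift.{v} A).toMonoidHom

/-- The second factor mapped to the indexed pushout. -/
def amalgamInr (ιA : C →* A) (ιB : C →* B) : B →* PushoutI (amalgamMap ιA ιB) :=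
  (PushoutI.of (φ := amalgamMap ιA ιB) true).comp
    (MulEquiv.ulift.symm : B ≃* ULift.{u} B).toMonoidHom

theorem amalgamInl_apply (ιA : C →* A) (ιB : C →* B) (c : C) :
    amalgamInl ιA ιB (ιA c) = PushoutI.base _ c :=
  PushoutI.of_apply_eq_base (amalgamMap ιA ιB) false c

theorem amalgamInr_apply (ιA : C →* A) (ιB : C →* B) (c : C) :
    amalgamInr ιA ιB (ιB c) = PushoutI.base _ c :=
  PushoutI.of_apply_eq_base (amalgamMap ιA ιB) true c

/-- The comparison map from the quotient of the free product to the indexed pushout. -/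
def amalgamToPushout (ιA : C →* A) (ιB : C →* B) :
    Coprod A B ⧸ amalgamRelations ιA ιB →* PushoutI (amalgamMap ιA ιB) :=
  QuotientGroup.lift _ (Coprod.lift (amalgamInl ιA ιB) (amalgamInr ιA ιB)) <| by
    refine Subgroup.normalClosure_le_normal ?_
    rintro _ ⟨c, rfl⟩
    simp [amalgamInl_apply, amalgamInr_apply]

@[simp]
theorem amalgamToPushout_mk_inl (ιA : C →* A) (ιB : C →* B) (a : A) :
    amalgamToPushout ιA ιB (QuotientGroup.mk (Coprod.inl a)) = amalgamInl ιA ιB a := by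
  simp [amalgamToPushout]

@[simp]
theorem amalgamToPushout_mk_inr (ιA : C →* A) (ιB : C →* B) (b : B) :
    amalgamToPushout ιA ιB (QuotientGroup.mk (Coprod.inr b)) = amalgamInr ιA ιB b := by
  simp [amalgamToPushout]

/-- The factors of the family mapped to the quotient of the free product. -/
def amalgamFactorToQuotient (ιA : C →* A) (ιB : C →* B) :
    ∀ b, AmalgamFactor A B b →* Coprod A B ⧸ amalgamRelations ιA ιB
  | false => ((QuotientGroup.mk' _).comp Coprod.inl).comp
      (MulEquiv.ulift : ULift.{v} A ≃* A).toMonoidHom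
  | true => ((QuotientGroup.mk' _).comp Coprod.inr).comp
      (MulEquiv.ulift : ULift.{u} B ≃* B).toMonoidHom

theorem amalgamToPushout_injective (ιA : C →* A) (ιB : C →* B) :
    Function.Injective (amalgamToPushout ιA ιB) := by
  let g : PushoutI (amalgamMap ιA ιB) →* Coprod A B ⧸ amalgamRelations ιA ιB :=
    PushoutI.lift (amalgamFactorToQuotient ιA ιB)
      (((QuotientGroup.mk' _).comp Coprod.inl).comp ιA) <| by
        rintro (_ | _)
        · rfl
        · ext c
          exact (mk_inl_eq_mk_inr ιA ιB c).symm
  have hg : g.comp (amalgamToPushout ιA ιB) = MonoidHom.id _ := by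
    refine QuotientGroup.monoidHom_ext _ (Coprod.hom_ext ?_ ?_)
    · ext a
      change g (amalgamToPushout ιA ιB (QuotientGroup.mk (Coprod.inl a))) = _
      rw [amalgamToPushout_mk_inl]
      exact PushoutI.lift_of ..
    · ext b
      change g (amalgamToPushout ιA ιB (QuotientGroup.mk (Coprod.inr b))) = _
      rw [amalgamToPushout_mk_inr]
      exact PushoutI.lift_of ..
  exact Function.LeftInverse.injective (DFunLike.congr_fun hg)

theorem amalgamToPushout_surjective (ιA : C →* A) (ιB : C →* B) :
    Function.Surjective (amalgamToPushout ιA ιB) := by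
  rw [← MonoidHom.range_eq_top, eq_top_iff]
  rintro x -
  induction x using PushoutI.induction_on with
  | of b y =>
    rcases b with _ | _
    · exact ⟨QuotientGroup.mk (Coprod.inl y.down), amalgamToPushout_mk_inl ..⟩
    · exact ⟨QuotientGroup.mk (Coprod.inr y.down), amalgamToPushout_mk_inr ..⟩
  | base c =>
    exact ⟨QuotientGroup.mk (Coprod.inl (ιA c)), by
      rw [amalgamToPushout_mk_inl, amalgamInl_apply]⟩
  | mul x y hx hy => exact mul_mem hx hy

theorem amalgamInl_injective {ιA : C →* A} {ιB : C →* B} (hA : Function.Injective ιA)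
    (hB : Function.Injective ιB) : Function.Injective (amalgamInl ιA ιB) :=
  (PushoutI.of_injective (amalgamMap_injective hA hB) false).comp
    (MulEquiv.ulift.symm : A ≃* ULift.{v} A).injective

theorem amalgamInr_injective {ιA : C →* A} {ιB : C →* B} (hA : Function.Injective ιA)
    (hB : Function.Injective ιB) : Function.Injective (amalgamInr ιA ιB) :=
  (PushoutI.of_injective (amalgamMap_injective hA hB) true).comp
    (MulEquiv.ulift.symm : B ≃* ULift.{u} B).injective

theorem base_mem_center_pushout_iff {ιA : C →* A} {ιB : C →* B} (hA : Function.Injective ιA)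
    (hB : Function.Injective ιB) (c : C) :
    PushoutI.base (amalgamMap ιA ιB) c ∈ Subgroup.center (PushoutI (amalgamMap ιA ιB)) ↔
      ιA c ∈ Subgroup.center A ∧ ιB c ∈ Subgroup.center B := by
  simp only [Subgroup.mem_center_iff]
  refine ⟨fun h => ⟨fun a => amalgamInl_injective hA hB ?_,
    fun b => amalgamInr_injective hA hB ?_⟩, fun ⟨hcA, hcB⟩ x => ?_⟩
  · simpa [amalgamInl_apply] using h (amalgamInl ιA ιB a)
  · simpa [amalgamInr_apply] using h (amalgamInr ιA ιB b)
  · induction x using PushoutI.induction_on with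
    | of b y =>
      rcases b with _ | _
      · rw [← amalgamInl_apply]
        change amalgamInl ιA ιB y.down * _ = _ * amalgamInl ιA ιB y.down
        rw [← map_mul, hcA, map_mul]
      · rw [← amalgamInr_apply]
        change amalgamInr ιA ιB y.down * _ = _ * amalgamInr ιA ιB y.down
        rw [← map_mul, hcB, map_mul]
    | base c' =>
      rw [← amalgamInl_apply, ← amalgamInl_apply, ← map_mul, hcA, map_mul]
    | mul x y hx hy => rw [mul_assoc, hy, ← mul_assoc, hx, mul_assoc]

end AmalgamatedProduct


/-- Lemma 10: Let `A ∗_C B` be the amalgamated free product (the pushout of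
`A ← C → B`, realised as the quotient of `A ∗ B` by the normal closure of the elements
`ιA(c)·ιB(c)⁻¹`), where `ιA`, `ιB` are injective with proper images.  Then an element is
central iff it is the image of some `c ∈ C` with `ιA c` central in `A` and `ιB c` central
in `B`. -/
theorem centre_of_amalgamated_product
    {A B C : Type*} [Group A] [Group B] [Group C]
    (ιA : C →* A) (ιB : C →* B)
    (hA : Function.Injective ιA) (hB : Function.Injective ιB)
    (hpA : ιA.range ≠ ⊤) (hpB : ιB.range ≠ ⊤)
    (x : Monoid.Coprod A B ⧸ Subgroup.normalClosure
        {u : Monoid.Coprod A B | ∃ c : C,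
          u = Monoid.Coprod.inl (ιA c) * (Monoid.Coprod.inr (ιB c))⁻¹}) :
    x ∈ Subgroup.center
        (Monoid.Coprod A B ⧸ Subgroup.normalClosure
          {u : Monoid.Coprod A B | ∃ c : C,
            u = Monoid.Coprod.inl (ιA c) * (Monoid.Coprod.inr (ιB c))⁻¹}) ↔
      ∃ c : C, x = QuotientGroup.mk (Monoid.Coprod.inl (ιA c)) ∧
        ιA c ∈ Subgroup.center A ∧ ιB c ∈ Subgroup.center B := by
  let e := MulEquiv.ofBijective (amalgamToPushout ιA ιB)
    ⟨amalgamToPushout_injective ιA ιB, amalgamToPushout_surjective ιA ιB⟩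
  have he (c : C) : e (QuotientGroup.mk (Monoid.Coprod.inl (ιA c))) =
      Monoid.PushoutI.base _ c :=
    (amalgamToPushout_mk_inl ..).trans (amalgamInl_apply ..)
  have hx : x ∈ Subgroup.center _ ↔ e x ∈ Subgroup.center _ :=
    (MulEquivClass.apply_mem_center_iff e).symm
  rw [hx]
  constructor
  · intro h
    obtain ⟨c, hc⟩ := Monoid.PushoutI.center_le_range_base (amalgamMap_injective hA hB)
      (amalgamMap_range_ne_top hpA hpB) h
    refine ⟨c, e.injective ((he c).trans hc).symm, ?_⟩
    rwa [← hc, base_mem_center_pushout_iff hA hB] at h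
  · rintro ⟨c, rfl, hc⟩
    rw [he]
    exact (base_mem_center_pushout_iff hA hB c).2 hc
end

section
/- Let a group A act on a group B by automorphisms via φ : A → Aut(B), let N be a normal subgroup of A, and let ψ : N → B be an injective homomorphism onto a subgroup N^ψ of B such that ψ(n^a) = (ψ(n))^{φ(a)} for all n ∈ N, a ∈ A, and conjugation by ψ(n) on B coincides with the automorphism φ(n) for all n ∈ N. Then the set {n·ψ(n)⁻¹ : n ∈ N}, viewed inside the semidirect product A ⋉ B, is a normal subgroup of A ⋉ B. -/
/-- Let `A` act on `B` by automorphisms via `φ : A →* MulAut B`, let `N ⊴ A`,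
and let `ψ : N → B` be an injective homomorphism consistent with the action, i.e.
`ψ(a n a⁻¹) = φ(a)(ψ n)` and conjugation by `ψ(n)` on `B` coincides with the automorphism
`φ(n)`.  Then `{n·ψ(n)⁻¹ : n ∈ N}` is a normal subgroup of the semidirect product
`B ⋊[φ] A`. -/
theorem set_is_normal_subgroup_of_semidirect
    {A B : Type*} [Group A] [Group B] (φ : A →* MulAut B)
    (N : Subgroup A) [hN : N.Normal] (ψ : N →* B) (hψ : Function.Injective ψ)
    (h1 : ∀ (a : A) (n : N),
      ψ ⟨a * (n : A) * a⁻¹, hN.conj_mem (n : A) n.2 a⟩ = φ a (ψ n))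
    (h2 : ∀ (n : N) (b : B), φ (n : A) b = ψ n * b * (ψ n)⁻¹) :
    ∃ K : Subgroup (B ⋊[φ] A), K.Normal ∧
      (K : Set (B ⋊[φ] A)) =
        {x | ∃ n : N, x = SemidirectProduct.inr (n : A) * SemidirectProduct.inl ((ψ n)⁻¹)} := by
  have key : ∀ n : N, (SemidirectProduct.inr (n : A) * SemidirectProduct.inl ((ψ n)⁻¹) :
      B ⋊[φ] A) = ⟨(ψ n)⁻¹, n⟩ := by
    intro n
    ext <;> simp [h2]
  let f : N →* B ⋊[φ] A :=
    { toFun := fun n => ⟨(ψ n)⁻¹, n⟩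
      map_one' := by ext <;> simp
      map_mul' := by
        intro n m
        ext <;> simp [h2, mul_assoc] }
  refine ⟨f.range, ⟨?_⟩, ?_⟩
  · rintro _ ⟨n, rfl⟩ g
    refine ⟨⟨g.right * n * g.right⁻¹, hN.conj_mem n n.2 g.right⟩, ?_⟩
    ext
    · simp only [f, MonoidHom.coe_mk, OneHom.coe_mk, h1]
      simp [h2]
      group
    · simp [f]
  · ext x
    simp only [key, SetLike.mem_coe, MonoidHom.mem_range, Set.mem_ofPred_eq]
    exact exists_congr fun n => eq_comm
end

section
/- Let I be a set, Ω a family of subsets of I, and for each i ∈ I let G_i be a group. For each ω ∈ Ω let N_ω be a normal subgroup of the free product ∗_{i∈ω} G_i, and set G_ω = (∗_{i∈ω} G_i)/N_ω and G_I = (∗_{i∈I} G_i)/⟨⟨⋃_{ω∈Ω} N_ω⟩⟩ (the quotient by the normal closure of the union of the images of the N_ω). Assume: (a) for each ω ∈ Ω and each i ∈ ω ∖ ⋂Ω, the intersection of N_ω with the subgroup ∗_{j∈ω∖{i}} G_j of ∗_{i∈ω} G_i is trivial; (b) for each finite subfamily F ⊆ Ω with |F| ≥ 2, there exist elements min, max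 ∈ ⋃F such that min belongs to precisely one set ω_min ∈ F, max belongs to precisely one set ω_max ∈ F, and ω_min ≠ ω_max. Then, for every ω ∈ Ω, the natural homomorphism φ_ω : G_ω → G_I is injective. -/
/-- The canonical homomorphism from the free product of the `G i` with `i ∈ ω'` to the free
product of the `G i` with `i ∈ ω`, for `ω' ⊆ ω`. -/
def inclHom {I : Type*} (G : I → Type*) [∀ i, Group (G i)] {ω' ω : Set I} (h : ω' ⊆ ω) :
    Monoid.CoprodI (fun i : ω' => G i) →* Monoid.CoprodI (fun i : ω => G i) :=
  Monoid.CoprodI.lift fun i => Monoid.CoprodI.of (M := fun i : ω => G i) (i := ⟨i.1, h i.2⟩)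

/-- The canonical homomorphism from the free product of the `G i` with `i ∈ ω` to the free
product of all the `G i`. -/
def toFull {I : Type*} (G : I → Type*) [∀ i, Group (G i)] (ω : Set I) :
    Monoid.CoprodI (fun i : ω => G i) →* Monoid.CoprodI G :=
  Monoid.CoprodI.lift fun i => Monoid.CoprodI.of (M := G) (i := i.1)

open Monoid (CoprodI)

universe u

/-- Two quotients of a group `C` can be amalgamated along a subgroup of `C` which meets both
kernels trivially. -/
theorem exists_amalgam_of_disjoint {C : Type u} [Group C] (L : Bool → Subgroup C)
    [∀ b, (L b).Normal] (A : Subgroup C) (hA : ∀ b, Disjoint (L b) A) :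
    ∃ (H : Type u) (_ : Group H) (f : Bool → C →* H),
      (∀ b x, f b x = 1 ↔ x ∈ L b) ∧ ∀ a ∈ A, f true a = f false a := by
  let φ : ∀ b, A →* C ⧸ L b := fun b => (QuotientGroup.mk' (L b)).comp A.subtype
  have hφ : ∀ b, Function.Injective (φ b) := fun b => by
    rw [injective_iff_map_eq_one]
    intro a h
    exact Subtype.ext (Subgroup.disjoint_def.mp (hA b) ((QuotientGroup.eq_one_iff _).mp h) a.2)
  refine ⟨Monoid.PushoutI φ, inferInstance,
    fun b => (Monoid.PushoutI.of b).comp (QuotientGroup.mk' (L b)), fun b x => ?_,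
    fun a ha => ?_⟩
  · rw [MonoidHom.comp_apply, map_eq_one_iff _ (Monoid.PushoutI.of_injective hφ b)]
    exact QuotientGroup.eq_one_iff x
  · exact (Monoid.PushoutI.of_apply_eq_base φ true ⟨a, ha⟩).trans
      (Monoid.PushoutI.of_apply_eq_base φ false ⟨a, ha⟩).symm

section FreeProduct

variable {I : Type*} (G : I → Type*) [∀ i, Group (G i)]

theorem toFull_of (ω : Set I) (i : ω) (g : G i) :
    toFull G ω (CoprodI.of (M := fun i : ω => G i) g) = CoprodI.of (M := G) g :=
  CoprodI.lift_of _ _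

theorem inclHom_of {ω' ω : Set I} (h : ω' ⊆ ω) (i : ω') (g : G i) :
    inclHom G h (CoprodI.of (M := fun i : ω' => G i) g) =
      CoprodI.of (M := fun i : ω => G i) (i := ⟨i.1, h i.2⟩) g :=
  CoprodI.lift_of _ _

open Classical in
/-- The retraction of the full free product onto the free product over `ω`. -/
noncomputable def retract (ω : Set I) : CoprodI G →* CoprodI (fun i : ω => G i) :=
  CoprodI.lift fun i =>
    if h : i ∈ ω then CoprodI.of (M := fun i : ω => G i) (i := ⟨i, h⟩) else 1

theorem retract_toFull (ω : Set I) (x : CoprodI (fun i : ω => G i)) :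
    retract G ω (toFull G ω x) = x := by
  suffices h : (retract G ω).comp (toFull G ω) = MonoidHom.id _ from DFunLike.congr_fun h x
  refine CoprodI.ext_hom _ _ fun i => MonoidHom.ext fun g => ?_
  simp [toFull_of, retract]

theorem toFull_injective (ω : Set I) : Function.Injective (toFull G ω) :=
  Function.LeftInverse.injective (retract_toFull G ω)

theorem mem_of_toFull_mem_normalClosure (ω : Set I)
    (N : Subgroup (CoprodI (fun i : ω => G i))) [N.Normal] {x : CoprodI (fun i : ω => G i)}
    (hx : toFull G ω x ∈ Subgroup.normalClosure (N.map (toFull G ω) : Set (CoprodI G))) :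
    x ∈ N := by
  have hle : Subgroup.normalClosure (N.map (toFull G ω) : Set (CoprodI G)) ≤
      N.comap (retract G ω) := by
    refine Subgroup.normalClosure_le_normal ?_
    rintro _ ⟨n, hn, rfl⟩
    change retract G ω (toFull G ω n) ∈ N
    rwa [retract_toFull]
  simpa [retract_toFull] using hle hx

/-- If the relations `N` over `ω` are added to a quotient of the free product whose relators `S`
do not involve the factor `m`, then no new relations appear between the remaining factors,
provided that the subproduct over `ω \ {m}` embeds into both quotients. -/
theorem mem_normalClosure_of_mem_normalClosure_union (m : I) (ω : Set I)
    (N : Subgroup (CoprodI (fun i : ω => G i))) [N.Normal]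
    (hN : N ⊓ (inclHom G (Set.sdiff_subset : ω \ {m} ⊆ ω)).range = ⊥)
    (S : Set (CoprodI G)) (hS : ∀ s ∈ S, ∃ ω' : Set I, m ∉ ω' ∧ s ∈ (toFull G ω').range)
    (hωS : ∀ x, toFull G ω x ∈ Subgroup.normalClosure S → x = 1)
    {ω₀ : Set I} (hm : m ∉ ω₀) {y : CoprodI G} (hy : y ∈ (toFull G ω₀).range)
    (hyS : y ∈ Subgroup.normalClosure (S ∪ N.map (toFull G ω))) :
    y ∈ Subgroup.normalClosure S := by
  classical
  let L : Bool → Subgroup (CoprodI G) := fun b =>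
    Subgroup.normalClosure (if b then S else N.map (toFull G ω))
  have : ∀ b, (L b).Normal := fun b => Subgroup.normalClosure_normal
  let A := (inclHom G (Set.sdiff_subset : ω \ {m} ⊆ ω)).range.map (toFull G ω)
  have hA : ∀ b, Disjoint (L b) A := by
    intro b
    rw [Subgroup.disjoint_def]
    rintro _ hxL ⟨x, hxr, rfl⟩
    suffices x = 1 by rw [this, map_one]
    cases b with
    | true => exact hωS x hxL
    | false =>
      rw [← Subgroup.mem_bot, ← hN]
      exact ⟨mem_of_toFull_mem_normalClosure G ω N hxL, hxr⟩
  obtain ⟨H, _, f, hf, hfA⟩ := exists_amalgam_of_disjoint L A hA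
  let F : CoprodI G →* H := CoprodI.lift fun i => (f (decide (i ≠ m))).comp CoprodI.of
  have hFaway : ∀ ω' : Set I, m ∉ ω' → ∀ s ∈ (toFull G ω').range, F s = f true s := by
    rintro ω' hω' _ ⟨x, rfl⟩
    suffices h : F.comp (toFull G ω') = (f true).comp (toFull G ω') from DFunLike.congr_fun h x
    refine CoprodI.ext_hom _ _ fun i => MonoidHom.ext fun g => ?_
    have hi : i.1 ≠ m := fun h => hω' (h ▸ i.2)
    simp [F, toFull_of, hi]
  have hFω : ∀ x, F (toFull G ω x) = f false (toFull G ω x) := by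
    intro x
    suffices h : F.comp (toFull G ω) = (f false).comp (toFull G ω) from DFunLike.congr_fun h x
    refine CoprodI.ext_hom _ _ fun i => MonoidHom.ext fun g => ?_
    by_cases hi : i.1 = m
    · simp [F, toFull_of, hi]
    · have hmem : CoprodI.of (M := G) g ∈ A :=
        ⟨CoprodI.of (M := fun i : ω => G i) g,
          ⟨CoprodI.of (M := fun j : (ω \ {m} : Set I) => G j) (i := ⟨i.1, i.2, hi⟩) g,
            inclHom_of G _ _ _⟩, toFull_of G ω i g⟩
      simp [F, toFull_of, hi, hfA _ hmem]
  have hker : Subgroup.normalClosure (S ∪ N.map (toFull G ω)) ≤ F.ker := by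
    refine Subgroup.normalClosure_le_normal (Set.union_subset (fun s hs => ?_) ?_)
    · obtain ⟨ω', hω', hs'⟩ := hS s hs
      change F s = 1
      rw [hFaway ω' hω' s hs', hf]
      exact Subgroup.subset_normalClosure hs
    · rintro _ ⟨n, hn, rfl⟩
      change F _ = 1
      rw [hFω, hf]
      exact Subgroup.subset_normalClosure ⟨n, hn, rfl⟩
  have hFy : F y = 1 := hker hyS
  rw [hFaway ω₀ hm y hy, hf] at hFy
  exact hFy

end FreeProduct

theorem exists_finset_mem_normalClosure {ι C : Type*} [Group C] (S : ι → Set C) {y : C}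
    (hy : y ∈ Subgroup.normalClosure (⋃ i, S i)) :
    ∃ F : Finset ι, y ∈ Subgroup.normalClosure (⋃ i ∈ F, S i) := by
  classical
  have hmono : ∀ {F F' : Finset ι}, F ⊆ F' →
      Subgroup.normalClosure (⋃ i ∈ F, S i) ≤ Subgroup.normalClosure (⋃ i ∈ F', S i) :=
    fun h => Subgroup.normalClosure_mono (Set.biUnion_subset_biUnion_left h)
  induction hy using Subgroup.closure_induction with
  | mem x hx =>
    obtain ⟨s, hs, hsx⟩ := Group.mem_conjugatesOfSet_iff.mp hx
    obtain ⟨i, hi⟩ := Set.mem_iUnion.mp hs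
    exact ⟨{i}, Subgroup.conjugatesOfSet_subset_normalClosure
      (Group.mem_conjugatesOfSet_iff.mpr ⟨s, by simpa using hi, hsx⟩)⟩
  | one => exact ⟨∅, one_mem _⟩
  | mul x y _ _ hx hy =>
    obtain ⟨F, hF⟩ := hx
    obtain ⟨F', hF'⟩ := hy
    exact ⟨F ∪ F', mul_mem (hmono Finset.subset_union_left hF)
      (hmono Finset.subset_union_right hF')⟩
  | inv x _ hx =>
    obtain ⟨F, hF⟩ := hx
    exact ⟨F, inv_mem hF⟩

/-- For finite subfamilies `F`, the kernel of the natural map from the free product over `ω₀`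
is contained in `N ω₀`, and is trivial if `ω₀` does not belong to `F`. -/
theorem mem_of_toFull_mem_normalClosure_biUnion
    {I : Type*} (G : I → Type*) [∀ i, Group (G i)]
    (Ω : Set (Set I))
    (N : (ω : Ω) → Subgroup (CoprodI (fun i : (ω : Set I) => G i)))
    [hNnormal : ∀ ω : Ω, (N ω).Normal]
    (ha : ∀ (ω : Ω), ∀ i ∈ (ω : Set I) \ ⋂₀ Ω,
      N ω ⊓ (inclHom G (Set.sdiff_subset : (ω : Set I) \ {i} ⊆ (ω : Set I))).range = ⊥)
    (hb : ∀ F : Set (Set I), F ⊆ Ω → F.Finite → 2 ≤ F.ncard →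
      ∃ mn mx : I, ∃ ωmin ∈ F, ∃ ωmax ∈ F, ωmin ≠ ωmax ∧
        mn ∈ ωmin ∧ (∀ ω' ∈ F, mn ∈ ω' → ω' = ωmin) ∧
        mx ∈ ωmax ∧ (∀ ω' ∈ F, mx ∈ ω' → ω' = ωmax))
    (F : Finset Ω) (ω₀ : Ω) (x : CoprodI (fun i : (ω₀ : Set I) => G i))
    (hx : toFull G ω₀ x ∈ Subgroup.normalClosure
      (⋃ ω ∈ F, ((N ω).map (toFull G ω) : Set (CoprodI G)))) :
    x ∈ N ω₀ ∧ (ω₀ ∉ F → x = 1) := by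
  classical
  induction F using Finset.strongInduction generalizing ω₀ x with
  | H F ih =>
  by_cases hF : F ⊆ {ω₀}
  · obtain rfl | rfl := Finset.subset_singleton_iff.mp hF
    · have h1 : x = 1 := toFull_injective G _ (by simpa using hx)
      exact ⟨h1 ▸ one_mem _, fun _ => h1⟩
    · exact ⟨mem_of_toFull_mem_normalClosure G _ _ (by simpa using hx), fun h => by simp at h⟩
  · obtain ⟨m, ω, hωF, hne, hmω, huniq⟩ : ∃ m : I, ∃ ω ∈ F, ω ≠ ω₀ ∧ m ∈ (ω : Set I) ∧
        ∀ ω' ∈ insert ω₀ F, m ∈ (ω' : Set I) → ω' = ω := by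
      have hcard : 2 ≤ (Subtype.val '' ((insert ω₀ F : Finset Ω) : Set Ω)).ncard := by
        rw [Set.ncard_image_of_injective _ Subtype.val_injective, Set.ncard_coe_finset]
        obtain ⟨ω, hω, hne⟩ := Finset.not_subset.mp hF
        exact Finset.one_lt_card.mpr ⟨ω, Finset.mem_insert_of_mem hω, ω₀,
          Finset.mem_insert_self _ _, by simpa using hne⟩
      obtain ⟨mn, mx, _, ⟨ω₁, h₁, rfl⟩, _, ⟨ω₂, h₂, rfl⟩, hne, hmn, hmn', hmx, hmx'⟩ :=
        hb _ (by rintro _ ⟨ω, -, rfl⟩; exact ω.2) ((Finset.finite_toSet _).image _) hcard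
      by_cases h : ω₁ = ω₀
      · have h' : ω₂ ≠ ω₀ := fun h' => hne (by rw [h, h'])
        exact ⟨mx, ω₂, Finset.mem_of_mem_insert_of_ne h₂ h', h', hmx,
          fun ω' hω' hm => Subtype.ext (hmx' _ ⟨ω', hω', rfl⟩ hm)⟩
      · exact ⟨mn, ω₁, Finset.mem_of_mem_insert_of_ne h₁ h, h, hmn,
          fun ω' hω' hm => Subtype.ext (hmn' _ ⟨ω', hω', rfl⟩ hm)⟩
    have hm₀ : m ∉ (ω₀ : Set I) := fun h => hne (huniq ω₀ (Finset.mem_insert_self _ _) h).symm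
    have hlt : F.erase ω ⊂ F := Finset.erase_ssubset hωF
    have key := mem_normalClosure_of_mem_normalClosure_union G m ω (N ω)
      (ha ω m ⟨hmω, fun h => hm₀ (h _ ω₀.2)⟩)
      (⋃ ω' ∈ F.erase ω, ((N ω').map (toFull G ω') : Set (CoprodI G)))
      (fun s hs => by
        simp only [Set.mem_iUnion] at hs
        obtain ⟨ω', hω', n, -, rfl⟩ := hs
        rw [Finset.mem_erase] at hω'
        exact ⟨ω', fun h => hω'.1 (huniq ω' (Finset.mem_insert_of_mem hω'.2) h), n, rfl⟩)
      (fun z hz => (ih _ hlt ω z hz).2 (Finset.notMem_erase _ _)) hm₀ ⟨x, rfl⟩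
      (by
        rw [← Finset.insert_erase hωF, Finset.set_biUnion_insert, Set.union_comm] at hx
        exact hx)
    have := ih _ hlt ω₀ x key
    exact ⟨this.1, fun h => this.2 fun h' => h (Finset.mem_of_mem_erase h')⟩

/-- Proposition 1, injectivity part: Given groups `G i` (`i ∈ I`), a family
`Ω` of subsets of `I`, and normal subgroups `N ω ⊴ ∗_{i∈ω} G i` for `ω ∈ Ω`, assume
(a) for each `ω ∈ Ω` and each `i ∈ ω ∖ ⋂Ω`, `N ω` meets the subproduct over `ω ∖ {i}`
trivially, and (b) every finite subfamily `F ⊆ Ω` with `|F| ≥ 2` has elements `min`, `max`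
lying in precisely one member `ω_min`, resp. `ω_max`, of `F`, with `ω_min ≠ ω_max`.  Then
each natural homomorphism `φ_ω : G_ω = (∗_{i∈ω} G i)/N ω → G_I` is injective. -/
theorem natural_maps_injective_of_FIAP_conditions
    {I : Type*} (G : I → Type*) [∀ i, Group (G i)]
    (Ω : Set (Set I))
    (N : (ω : Ω) → Subgroup (Monoid.CoprodI (fun i : (ω : Set I) => G i)))
    [hNnormal : ∀ ω : Ω, (N ω).Normal]
    (ha : ∀ (ω : Ω), ∀ i ∈ (ω : Set I) \ ⋂₀ Ω,
      N ω ⊓ (inclHom G (Set.diff_subset : (ω : Set I) \ {i} ⊆ (ω : Set I))).range = ⊥)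
    (hb : ∀ F : Set (Set I), F ⊆ Ω → F.Finite → 2 ≤ F.ncard →
      ∃ mn mx : I, ∃ ωmin ∈ F, ∃ ωmax ∈ F, ωmin ≠ ωmax ∧
        mn ∈ ωmin ∧ (∀ ω' ∈ F, mn ∈ ω' → ω' = ωmin) ∧
        mx ∈ ωmax ∧ (∀ ω' ∈ F, mx ∈ ω' → ω' = ωmax))
    (ω : Ω) :
    Function.Injective ⇑(QuotientGroup.lift (N ω)
      ((QuotientGroup.mk' (Subgroup.normalClosure
          (⋃ ω' : Ω, ((N ω').map (toFull G ω') : Set (Monoid.CoprodI G))))).comp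
        (toFull G ω))
      (fun x hx => (QuotientGroup.eq_one_iff _).mpr
        (Subgroup.subset_normalClosure
          (Set.mem_iUnion.mpr ⟨ω, Subgroup.mem_map.mpr ⟨x, hx, rfl⟩⟩)))) := by
  rw [injective_iff_map_eq_one]
  intro q hq
  induction q using QuotientGroup.induction_on with
  | H x =>
  obtain ⟨F, hF⟩ := exists_finset_mem_normalClosure _ ((QuotientGroup.eq_one_iff _).mp hq)
  exact (QuotientGroup.eq_one_iff x).mpr
    (mem_of_toFull_mem_normalClosure_biUnion G Ω N ha hb F ω x hF).1
end

section
/- Let I be a set, Ω a family of subsets of I, groups G_i (i ∈ I), and normal subgroups N_ω ⊴ ∗_{i∈ω} G_i (ω ∈ Ω) satisfying: (a) for each ω ∈ Ω and each i ∈ ω ∖ ⋂Ω, the intersection of N_ω with the subgroup ∗_{j∈ω∖{i}} G_j is trivial; (b) for each finite subfamily F ⊆ Ω with |F| ≥ 2, there exist elements min, max ∈ ⋃F such that min belongs to precisely one set ω_min ∈ F, max belongs to precisely one set ω_max ∈ F, and ω_min ≠ ω_max. Let Ω' be a finite subfamily of Ω, let ω ∈ Ω, and let α be a proper subset of ω with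 ⋂Ω ⊆ α ⊆ ω ∩ ⋃Ω'. Then the natural homomorphism ∗_{i∈α} G_i → G_{Ω'} = (∗_{i∈⋃Ω'} G_i)/⟨⟨⋃_{ω'∈Ω'} N_{ω'}⟩⟩ is injective. -/
universe u v

open Monoid

/-- Two injective homomorphisms with a common source embed into an amalgam. -/
theorem exists_amalgam_injective {H : Type u} {A B : Type v} [Group H] [Group A] [Group B]
    (φ : H →* A) (ψ : H →* B) (hφ : Function.Injective φ) (hψ : Function.Injective ψ) :
    ∃ (Γ : Type (max u v)) (_ : Group Γ) (f : A →* Γ) (g : B →* Γ),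
      Function.Injective f ∧ f.comp φ = g.comp ψ := by
  suffices key : ∀ (K : Bool → Type v) [∀ b, Group (K b)] (θ : ∀ b, H →* K b),
      (∀ b, Function.Injective (θ b)) →
      ∃ (Γ : Type (max u v)) (_ : Group Γ) (f : K true →* Γ) (g : K false →* Γ),
        Function.Injective f ∧ f.comp (θ true) = g.comp (θ false) from
    @key (Bool.rec B A) (Bool.rec ‹Group B› ‹Group A›) (Bool.rec ψ φ) (Bool.rec hψ hφ)
  intro K _ θ hθ
  exact ⟨PushoutI θ, inferInstance, PushoutI.of true, PushoutI.of false,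
    PushoutI.of_injective hθ true,
    (PushoutI.of_comp_eq_base (φ := θ) true).trans (PushoutI.of_comp_eq_base (φ := θ) false).symm⟩

section

variable {I : Type*} (G : I → Type*) [∀ i, Group (G i)]

/-- The canonical homomorphism from the free product of the `G i` with `i ∈ s` to the free
product of all the `G i`. -/
def subproductHom (s : Set I) : CoprodI (fun i : s => G i) →* CoprodI G :=
  CoprodI.lift fun i => CoprodI.of (M := G) (i := i.1)

open Classical in
/-- The projection of the free product of all the `G i` onto the free product of the `G i` with
`i ∈ s`, killing the other factors. -/
noncomputable def subproductProj (s : Set I) : CoprodI G →* CoprodI (fun i : s => G i) :=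
  CoprodI.lift fun i =>
    if h : i ∈ s then CoprodI.of (M := fun i : s => G i) (i := ⟨i, h⟩) else 1

theorem subproductHom_comp_inclHom {s t : Set I} (h : s ⊆ t) :
    (subproductHom G t).comp (inclHom G h) = subproductHom G s := by
  ext i x
  simp [subproductHom, inclHom]

theorem subproductHom_inclHom {s t : Set I} (h : s ⊆ t) (w : CoprodI (fun i : s => G i)) :
    subproductHom G t (inclHom G h w) = subproductHom G s w :=
  DFunLike.congr_fun (subproductHom_comp_inclHom G h) w

theorem subproductProj_subproductHom (s : Set I) (w : CoprodI (fun i : s => G i)) :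
    subproductProj G s (subproductHom G s w) = w := by
  have : (subproductProj G s).comp (subproductHom G s) = MonoidHom.id _ := by
    ext i x
    simp [subproductHom, subproductProj]
  exact DFunLike.congr_fun this w

theorem inclHom_injective {s t : Set I} (h : s ⊆ t) : Function.Injective (inclHom G h) := by
  intro a b hab
  rw [← subproductProj_subproductHom G s a, ← subproductProj_subproductHom G s b,
    ← subproductHom_inclHom G h, ← subproductHom_inclHom G h, hab]

variable {G} {Ω : Set (Set I)}

/-- The normal closure, in the free product of all the `G i`, of the subgroups `N ω` with
`ω ∈ F`. -/
def relationClosure (N : (ω : Ω) → Subgroup (CoprodI (fun i : (ω : Set I) => G i)))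
    (F : Set (Set I)) : Subgroup (CoprodI G) :=
  Subgroup.normalClosure {p | ∃ ω : Ω, (ω : Set I) ∈ F ∧ ∃ n ∈ N ω, subproductHom G ω n = p}

instance (N : (ω : Ω) → Subgroup (CoprodI (fun i : (ω : Set I) => G i))) (F : Set (Set I)) :
    (relationClosure N F).Normal :=
  Subgroup.normalClosure_normal

variable {N : (ω : Ω) → Subgroup (CoprodI (fun i : (ω : Set I) => G i))}

theorem subproductHom_mem_relationClosure {F : Set (Set I)} {ω : Ω} (hω : (ω : Set I) ∈ F)
    {n : CoprodI (fun i : (ω : Set I) => G i)} (hn : n ∈ N ω) :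
    subproductHom G ω n ∈ relationClosure N F :=
  Subgroup.subset_normalClosure ⟨ω, hω, n, hn, rfl⟩

theorem relationClosure_le {F : Set (Set I)} {K : Subgroup (CoprodI G)} [K.Normal]
    (h : ∀ ω : Ω, (ω : Set I) ∈ F → ∀ n ∈ N ω, subproductHom G ω n ∈ K) :
    relationClosure N F ≤ K :=
  Subgroup.normalClosure_le_normal (by rintro _ ⟨ω, hω, n, hn, rfl⟩; exact h ω hω n hn)

theorem eq_one_of_inclHom_mem {ω : Ω} {i : I}
    (h : N ω ⊓ (inclHom G (Set.sdiff_subset : (ω : Set I) \ {i} ⊆ (ω : Set I))).range = ⊥)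
    {w : CoprodI (fun j : ((ω : Set I) \ {i} : Set I) => G j)}
    (hw : inclHom G Set.sdiff_subset w ∈ N ω) : w = 1 := by
  have hb : inclHom G Set.sdiff_subset w ∈ (⊥ : Subgroup _) := h ▸ ⟨hw, w, rfl⟩
  exact inclHom_injective G _ ((Subgroup.mem_bot.1 hb).trans (map_one _).symm)

/-- A subproduct missing one element `i` of `ω` survives in the quotient of the free product by
the relations of `ω` alone. -/
theorem eq_one_of_mem_relationClosure_of_subset_singleton {ω : Ω} [(N ω).Normal] {i : I}
    (h : N ω ⊓ (inclHom G (Set.sdiff_subset : (ω : Set I) \ {i} ⊆ (ω : Set I))).range = ⊥)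
    {F : Set (Set I)} (hF : F ⊆ {(ω : Set I)})
    {w : CoprodI (fun j : ((ω : Set I) \ {i} : Set I) => G j)}
    (hw : subproductHom G _ w ∈ relationClosure N F) : w = 1 := by
  have hle : relationClosure N F ≤ (N ω).comap (subproductProj G ω) := by
    refine relationClosure_le fun ω' hω' n hn => ?_
    obtain rfl : ω' = ω := Subtype.ext (hF hω')
    rwa [Subgroup.mem_comap, subproductProj_subproductHom]
  refine eq_one_of_inclHom_mem h ?_
  have := hle hw
  rwa [← subproductHom_inclHom G (Set.sdiff_subset : (ω : Set I) \ {i} ⊆ (ω : Set I)),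
    Subgroup.mem_comap, subproductProj_subproductHom] at this

/-- If `x ∈ ω₀` lies in no member of `F`, and the subproduct over `ω₀ \ {x}` survives both
modulo `N ω₀` and modulo the relations of `F`, then adding the relations of `ω₀` to those of `F`
kills no new element of a subproduct not involving `x`. -/
theorem mem_relationClosure_of_mem_insert {ω₀ : Ω} [(N ω₀).Normal] {F : Set (Set I)} {x : I}
    (hxF : ∀ ω ∈ F, x ∉ ω)
    (h₀ : N ω₀ ⊓ (inclHom G (Set.sdiff_subset : (ω₀ : Set I) \ {x} ⊆ (ω₀ : Set I))).range = ⊥)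
    (hF : ∀ w : CoprodI (fun j : ((ω₀ : Set I) \ {x} : Set I) => G j),
      subproductHom G _ w ∈ relationClosure N F → w = 1)
    {s : Set I} (hxs : x ∉ s) {w : CoprodI (fun j : s => G j)}
    (hw : subproductHom G s w ∈ relationClosure N (insert (ω₀ : Set I) F)) :
    subproductHom G s w ∈ relationClosure N F := by
  classical
  let q := QuotientGroup.mk' (relationClosure N F)
  let q₀ := QuotientGroup.mk' (N ω₀)
  obtain ⟨Γ, _, f, g, hf, hfg⟩ := exists_amalgam_injective
    (q.comp (subproductHom G ((ω₀ : Set I) \ {x})))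
    (q₀.comp (inclHom G (Set.sdiff_subset : (ω₀ : Set I) \ {x} ⊆ (ω₀ : Set I))))
    ((injective_iff_map_eq_one _).2 fun a ha => hF a ((QuotientGroup.eq_one_iff _).1 ha))
    ((injective_iff_map_eq_one _).2 fun a ha =>
      eq_one_of_inclHom_mem h₀ ((QuotientGroup.eq_one_iff _).1 ha))
  let Φ : CoprodI G →* Γ := CoprodI.lift fun i =>
    if h : i = x ∧ i ∈ (ω₀ : Set I) then
      (g.comp q₀).comp (CoprodI.of (M := fun i : (ω₀ : Set I) => G i) (i := ⟨i, h.2⟩))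
    else (f.comp q).comp CoprodI.of
  have hΦ : ∀ t : Set I, x ∉ t → ∀ a : CoprodI (fun j : t => G j),
      Φ (subproductHom G t a) = f (q (subproductHom G t a)) := by
    intro t hxt a
    have : Φ.comp (subproductHom G t) = (f.comp q).comp (subproductHom G t) := by
      ext i y
      have hi : (i : I) ≠ x := fun h => hxt (h ▸ i.2)
      simp [Φ, subproductHom, hi]
    exact DFunLike.congr_fun this a
  have hΦ₀ : Φ.comp (subproductHom G ω₀) = g.comp q₀ := by
    ext i y
    by_cases hi : (i : I) = x
    · have hx : (i : I) = x ∧ (i : I) ∈ (ω₀ : Set I) := ⟨hi, i.2⟩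
      simp only [Φ, subproductHom, MonoidHom.comp_apply, CoprodI.lift_of, dif_pos hx]
    · have := DFunLike.congr_fun hfg
        (CoprodI.of (M := fun j : ((ω₀ : Set I) \ {x} : Set I) => G j) (i := ⟨i, i.2, hi⟩) y)
      simpa [Φ, subproductHom, inclHom, hi] using this
  have hle : relationClosure N (insert (ω₀ : Set I) F) ≤ Φ.ker := by
    refine relationClosure_le fun ω hω n hn => ?_
    rw [MonoidHom.mem_ker]
    rcases hω with hω | hω
    · obtain rfl : ω = ω₀ := Subtype.ext hω
      have := DFunLike.congr_fun hΦ₀ n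
      rw [MonoidHom.comp_apply] at this
      have hq : q₀ n = 1 := (QuotientGroup.eq_one_iff n).2 hn
      rw [this, MonoidHom.comp_apply, hq, map_one]
    · have hq : q (subproductHom G ω n) = 1 :=
        (QuotientGroup.eq_one_iff _).2 (subproductHom_mem_relationClosure hω hn)
      rw [hΦ _ (hxF _ hω), hq, map_one]
  have hw' := hle hw
  rw [MonoidHom.mem_ker, hΦ s hxs] at hw'
  exact (QuotientGroup.eq_one_iff _).1 (hf (hw'.trans (map_one f).symm))

theorem eq_one_of_mem_relationClosure [∀ ω : Ω, (N ω).Normal]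
    (ha : ∀ (ω : Ω), ∀ i ∈ (ω : Set I) \ ⋂₀ Ω,
      N ω ⊓ (inclHom G (Set.sdiff_subset : (ω : Set I) \ {i} ⊆ (ω : Set I))).range = ⊥)
    (hb : ∀ F : Set (Set I), F ⊆ Ω → F.Finite → 2 ≤ F.ncard →
      ∃ mn mx : I, ∃ ωmin ∈ F, ∃ ωmax ∈ F, ωmin ≠ ωmax ∧
        mn ∈ ωmin ∧ (∀ ω' ∈ F, mn ∈ ω' → ω' = ωmin) ∧
        mx ∈ ωmax ∧ (∀ ω' ∈ F, mx ∈ ω' → ω' = ωmax))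
    {F : Set (Set I)} (hFΩ : F ⊆ Ω) (hF : F.Finite) (ω : Ω) {i : I}
    (hi : i ∈ (ω : Set I) \ ⋂₀ Ω)
    {w : CoprodI (fun j : ((ω : Set I) \ {i} : Set I) => G j)}
    (hw : subproductHom G _ w ∈ relationClosure N F) : w = 1 := by
  induction hn : F.ncard using Nat.strong_induction_on generalizing F ω i with
  | _ n ih =>
    by_cases hFω : F ⊆ {(ω : Set I)}
    · exact eq_one_of_mem_relationClosure_of_subset_singleton (ha ω i hi) hFω hw
    obtain ⟨ω₀, hω₀F, hne, x, hx, hxu⟩ : ∃ ω₀ ∈ F, ω₀ ≠ ω ∧ ∃ x ∈ ω₀,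
        ∀ ω' ∈ insert (ω : Set I) F, x ∈ ω' → ω' = ω₀ := by
      obtain ⟨ω₁, hω₁, hne₁⟩ := Set.not_subset.1 hFω
      have hfin : (insert (ω : Set I) F).Finite := hF.insert _
      obtain ⟨mn, mx, ωmin, hmin, ωmax, hmax, hne, h1, h2, h3, h4⟩ :=
        hb _ (Set.insert_subset ω.2 hFΩ) hfin
          ((Set.one_lt_ncard hfin).2 ⟨_, Or.inl rfl, _, Or.inr hω₁, Ne.symm hne₁⟩)
      by_cases h : ωmin = ω
      · exact ⟨ωmax, hmax.resolve_left fun h' => hne (h.trans h'.symm),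
          fun h' => hne (h.trans h'.symm), mx, h3, h4⟩
      · exact ⟨ωmin, hmin.resolve_left h, h, mn, h1, h2⟩
    have hxω : x ∉ (ω : Set I) := fun h => hne (hxu _ (Or.inl rfl) h).symm
    have hx₀ : x ∈ ω₀ \ ⋂₀ Ω := ⟨hx, fun h => hxω (h ω ω.2)⟩
    have hlt : (F \ {ω₀}).ncard < n := hn ▸ Set.ncard_sdiff_singleton_lt_of_mem hω₀F hF
    have ih' := fun ω i hi w hw =>
      ih _ hlt (F := F \ {ω₀}) (Set.sdiff_subset.trans hFΩ) hF.sdiff ω (i := i) hi (w := w) hw rfl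
    refine ih' ω i hi w ?_
    refine mem_relationClosure_of_mem_insert (ω₀ := ⟨ω₀, hFΩ hω₀F⟩) (x := x)
      (fun ω' hω' h => hω'.2 (hxu ω' (Or.inr hω'.1) h)) (ha ⟨ω₀, hFΩ hω₀F⟩ x hx₀)
      (ih' ⟨ω₀, hFΩ hω₀F⟩ x hx₀) (fun h => hxω h.1) ?_
    rwa [Set.insert_sdiff_singleton, Set.insert_eq_of_mem hω₀F]

end

/-- Lemma 8: Given groups `G i` (`i ∈ I`), a family `Ω` of subsets of `I`, and
normal subgroups `N ω ⊴ ∗_{i∈ω} G i` for `ω ∈ Ω` satisfying conditions (a) and (b) of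
Proposition 1, let `Ω'` be a finite subfamily of `Ω`, let `ω ∈ Ω`, and let `α` be a proper
subset of `ω` with `⋂Ω ⊆ α ⊆ ω ∩ ⋃Ω'`.  Then the natural homomorphism
`∗_{i∈α} G i → G_{Ω'} = (∗_{i∈⋃Ω'} G i)/⟨⟨⋃_{ω'∈Ω'} N ω'⟩⟩` is injective. -/
theorem subproduct_injective_in_finite_quotient
    {I : Type*} (G : I → Type*) [∀ i, Group (G i)]
    (Ω : Set (Set I))
    (N : (ω : Ω) → Subgroup (Monoid.CoprodI (fun i : (ω : Set I) => G i)))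
    [hNnormal : ∀ ω : Ω, (N ω).Normal]
    (ha : ∀ (ω : Ω), ∀ i ∈ (ω : Set I) \ ⋂₀ Ω,
      N ω ⊓ (inclHom G (Set.diff_subset : (ω : Set I) \ {i} ⊆ (ω : Set I))).range = ⊥)
    (hb : ∀ F : Set (Set I), F ⊆ Ω → F.Finite → 2 ≤ F.ncard →
      ∃ mn mx : I, ∃ ωmin ∈ F, ∃ ωmax ∈ F, ωmin ≠ ωmax ∧
        mn ∈ ωmin ∧ (∀ ω' ∈ F, mn ∈ ω' → ω' = ωmin) ∧
        mx ∈ ωmax ∧ (∀ ω' ∈ F, mx ∈ ω' → ω' = ωmax))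
    (Ω' : Set (Set I)) (hΩ'Ω : Ω' ⊆ Ω) (hΩ'fin : Ω'.Finite)
    (ω : Ω) (α : Set I) (hαω : α ⊂ (ω : Set I)) (hint : ⋂₀ Ω ⊆ α)
    (hα : α ⊆ (ω : Set I) ∩ ⋃₀ Ω') :
    Function.Injective
      ⇑((QuotientGroup.mk' (Subgroup.normalClosure
          (⋃ ω' : Ω', ((N ⟨(ω' : Set I), hΩ'Ω ω'.2⟩).map
              (inclHom G (fun _ hi => Set.mem_sUnion.mpr ⟨(ω' : Set I), ω'.2, hi⟩))
            : Set (Monoid.CoprodI (fun i : (⋃₀ Ω' : Set I) => G i)))))).comp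
        (inclHom G (fun i hi => (hα hi).2))) := by
  rw [injective_iff_map_eq_one]
  intro w hw
  obtain ⟨i, hiω, hiα⟩ := Set.exists_of_ssubset hαω
  have hsub : α ⊆ (ω : Set I) \ {i} := fun j hj => ⟨hαω.1 hj, fun h => hiα (h ▸ hj)⟩
  have hle : Subgroup.normalClosure (⋃ ω' : Ω', ((N ⟨(ω' : Set I), hΩ'Ω ω'.2⟩).map
      (inclHom G (fun _ hi => Set.mem_sUnion.mpr ⟨(ω' : Set I), ω'.2, hi⟩))
        : Set (Monoid.CoprodI (fun i : (⋃₀ Ω' : Set I) => G i)))) ≤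
      (relationClosure N Ω').comap (subproductHom G (⋃₀ Ω')) := by
    refine Subgroup.normalClosure_le_normal (Set.iUnion_subset fun ω' => ?_)
    rintro _ ⟨n, hn, rfl⟩
    have hmem := subproductHom_mem_relationClosure (ω := ⟨(ω' : Set I), hΩ'Ω ω'.2⟩) ω'.2 hn
    rwa [← subproductHom_inclHom G (Set.subset_sUnion_of_mem ω'.2)] at hmem
  have hmem : subproductHom G _ (inclHom G hsub w) ∈ relationClosure N Ω' := by
    rw [subproductHom_inclHom, ← subproductHom_inclHom G (hα.trans Set.inter_subset_right)]
    exact hle ((QuotientGroup.eq_one_iff _).1 hw)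
  exact inclHom_injective G hsub
    ((eq_one_of_mem_relationClosure ha hb hΩ'Ω hΩ'fin ω ⟨hiω, fun h => hiα (hint h)⟩ hmem).trans
      (map_one _).symm)
end
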